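/- arXiv:2411.06013 — 2 statements merged into one kernel-verified Lean document; each statement's English description precedes it below -/
import Mathlib

section
/- Let d ≥ 2 and let μ_O denote the Haar probability measure on O(d). For every complex matrix A indexed by (Fin d × Fin d) × (Fin d × Fin d), one has ∫_{O(d)} (O ⊗ O)·A·(Oᵀ ⊗ Oᵀ) dμ_O(O) = γ₁·(1_d ⊗ 1_d) + γ₂·S + γ₃·Π, where γ₁ = ((d+1)tr(A) − tr(S·A) − tr(Π·A)) / (d(d−1)(d+2)), γ₂ = (−tr(A) + (d+1)tr(S·A) − tr(Π·A)) / (d(d−1)(d+2)), and γ₃ = (−tr(A) − tr(S·A) + (d+1)tr(Π·A)) / (d(d−1)(d+2)). -/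
open MeasureTheory Matrix Kronecker

attribute [local instance] Matrix.normedAddCommGroup Matrix.normedSpace

/-- Entrywise coercion of a real orthogonal matrix to a complex matrix. -/
def OC {d : ℕ} (O : Matrix.orthogonalGroup (Fin d) ℝ) : Matrix (Fin d) (Fin d) ℂ :=
  (O : Matrix (Fin d) (Fin d) ℝ).map Complex.ofReal

/-- The swap operator `S` with entries `S_{(j,k),(l,m)} = δ_{jm} δ_{kl}`. -/
def swapOp (d : ℕ) : Matrix (Fin d × Fin d) (Fin d × Fin d) ℂ :=
  Matrix.of fun p q => if p.1 = q.2 ∧ p.2 = q.1 then 1 else 0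

/-- The operator `Π = Σ_{j,k} |jj⟩⟨kk|` with entries `Π_{(j,k),(l,m)} = δ_{jk} δ_{lm}`. -/
def piOp (d : ℕ) : Matrix (Fin d × Fin d) (Fin d × Fin d) ℂ :=
  Matrix.of fun p q => if p.1 = p.2 ∧ q.1 = q.2 then 1 else 0

instance compactSpace_orthogonalGroup (d : ℕ) :
    CompactSpace (Matrix.orthogonalGroup (Fin d) ℝ) := by
  have hclosed : IsClosed (Matrix.orthogonalGroup (Fin d) ℝ : Set (Matrix (Fin d) (Fin d) ℝ)) :=
    isClosed_unitary
  refine isCompact_iff_compactSpace.mp (Metric.isCompact_of_isClosed_isBounded hclosed ?_)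
  refine (Metric.isBounded_closedBall (x := (0 : Matrix (Fin d) (Fin d) ℝ)) (r := 1)).subset ?_
  intro U hU
  rw [mem_closedBall_zero_iff, Matrix.norm_le_iff zero_le_one]
  exact entry_norm_bound_of_unitary hU

section TensorSquare

variable {d : ℕ}

lemma OC_mul (O Q : Matrix.orthogonalGroup (Fin d) ℝ) : OC (O * Q) = OC O * OC Q := by
  exact Matrix.map_mul (f := Complex.ofRealHom)

lemma OC_transpose_mul_self (O : Matrix.orthogonalGroup (Fin d) ℝ) : (OC O)ᵀ * OC O = 1 := by
  have h := (Matrix.mem_orthogonalGroup_iff' (Fin d) ℝ).mp O.2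
  rw [OC, ← Matrix.transpose_map]
  change (_ : Matrix _ _ ℝ).map Complex.ofRealHom * (_ : Matrix _ _ ℝ).map Complex.ofRealHom = 1
  rw [← Matrix.map_mul, h]
  simp

lemma continuous_OC : Continuous (OC : Matrix.orthogonalGroup (Fin d) ℝ → _) :=
  continuous_subtype_val.matrix_map Complex.continuous_ofReal

/-- Conjugation of `A` by the tensor square of `Q`, for orthogonal `Q`. -/
def conjTensorSquare (Q : Matrix (Fin d) (Fin d) ℂ)
    (A : Matrix (Fin d × Fin d) (Fin d × Fin d) ℂ) :
    Matrix (Fin d × Fin d) (Fin d × Fin d) ℂ :=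
  (Q ⊗ₖ Q) * A * (Qᵀ ⊗ₖ Qᵀ)

lemma conjTensorSquare_mul (P Q : Matrix (Fin d) (Fin d) ℂ)
    (A : Matrix (Fin d × Fin d) (Fin d × Fin d) ℂ) :
    conjTensorSquare (P * Q) A = conjTensorSquare P (conjTensorSquare Q A) := by
  simp only [conjTensorSquare, Matrix.transpose_mul, Matrix.mul_kronecker_mul, Matrix.mul_assoc]

lemma conjTensorSquare_apply (Q : Matrix (Fin d) (Fin d) ℂ)
    (A : Matrix (Fin d × Fin d) (Fin d × Fin d) ℂ) (i j k l : Fin d) :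
    conjTensorSquare Q A (i, j) (k, l) =
      ∑ a, ∑ b, ∑ c, ∑ e, Q i a * Q j b * Q k c * Q l e * A (a, b) (c, e) := by
  have h : ∀ F : Fin d × Fin d → Fin d × Fin d → ℂ,
      ∑ c, ∑ e, ∑ a, ∑ b, F (a, b) (c, e) = ∑ a, ∑ b, ∑ c, ∑ e, F (a, b) (c, e) := fun F => by
    simpa only [Fintype.sum_prod_type] using
      Finset.sum_comm (s := Finset.univ) (t := Finset.univ) (f := fun q p => F p q)
  simp only [conjTensorSquare, Matrix.mul_apply, Fintype.sum_prod_type, Matrix.kronecker_apply,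
    Matrix.transpose_apply, Finset.sum_mul]
  rw [h fun p q => Q i p.1 * Q j p.2 * A p q * (Q k q.1 * Q l q.2)]
  refine Finset.sum_congr rfl fun a _ => Finset.sum_congr rfl fun b _ =>
    Finset.sum_congr rfl fun c _ => Finset.sum_congr rfl fun e _ => ?_
  ring

/-- Conjugation by a tensor square as a linear map. -/
def conjTensorSquareL (Q : Matrix (Fin d) (Fin d) ℂ) :
    Matrix (Fin d × Fin d) (Fin d × Fin d) ℂ →ₗ[ℂ] Matrix (Fin d × Fin d) (Fin d × Fin d) ℂ where
  toFun := conjTensorSquare Q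
  map_add' A B := by simp [conjTensorSquare, mul_add, add_mul]
  map_smul' c A := by simp [conjTensorSquare]

/-- The functional `A ↦ tr (P A)` as a linear map. -/
def traceMulL (P : Matrix (Fin d × Fin d) (Fin d × Fin d) ℂ) :
    Matrix (Fin d × Fin d) (Fin d × Fin d) ℂ →ₗ[ℂ] ℂ where
  toFun A := (P * A).trace
  map_add' A B := by simp [mul_add]
  map_smul' c A := by simp

lemma trace_mul_conjTensorSquare {P : Matrix (Fin d × Fin d) (Fin d × Fin d) ℂ}
    {Q : Matrix (Fin d) (Fin d) ℂ} (hQ : Qᵀ * Q = 1) (hP : (Q ⊗ₖ Q) * P = P * (Q ⊗ₖ Q))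
    (A : Matrix (Fin d × Fin d) (Fin d × Fin d) ℂ) :
    (P * conjTensorSquare Q A).trace = (P * A).trace := by
  rw [conjTensorSquare, ← Matrix.mul_assoc, ← Matrix.mul_assoc, Matrix.trace_mul_comm,
    ← hP, Matrix.mul_assoc, ← Matrix.mul_assoc, ← Matrix.mul_kronecker_mul, hQ,
    Matrix.one_kronecker_one, Matrix.one_mul]

lemma kronecker_mul_swapOp (Q : Matrix (Fin d) (Fin d) ℂ) :
    (Q ⊗ₖ Q) * swapOp d = swapOp d * (Q ⊗ₖ Q) := by
  ext ⟨i, j⟩ ⟨k, l⟩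
  simp [Matrix.mul_apply, swapOp, Fintype.sum_prod_type, ite_and, mul_comm]

lemma kronecker_mul_piOp {Q : Matrix (Fin d) (Fin d) ℂ} (hQ : Qᵀ * Q = 1) :
    (Q ⊗ₖ Q) * piOp d = piOp d * (Q ⊗ₖ Q) := by
  have hQ' : Q * Qᵀ = 1 := mul_eq_one_comm.mp hQ
  ext ⟨i, j⟩ ⟨k, l⟩
  have h₁ := congrFun (congrFun hQ k) l
  have h₂ := congrFun (congrFun hQ' i) j
  simp only [Matrix.mul_apply, Matrix.transpose_apply, Matrix.one_apply] at h₁ h₂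
  simp [Matrix.mul_apply, piOp, Fintype.sum_prod_type, ite_and, h₁, h₂]
  split_ifs <;> rfl

lemma trace_swapOp : (swapOp d).trace = d := by
  simp [Matrix.trace, swapOp, Fintype.sum_prod_type, ite_and, eq_comm]

lemma trace_piOp : (piOp d).trace = d := by
  simp [Matrix.trace, piOp, Fintype.sum_prod_type, -Finset.sum_boole]

lemma swapOp_mul_swapOp : swapOp d * swapOp d = 1 := by
  ext ⟨i, j⟩ ⟨k, l⟩
  simp [Matrix.mul_apply, swapOp, Fintype.sum_prod_type, ite_and, Matrix.one_apply]

lemma swapOp_mul_piOp : swapOp d * piOp d = piOp d := by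
  ext ⟨i, j⟩ ⟨k, l⟩
  simp [Matrix.mul_apply, swapOp, piOp, Fintype.sum_prod_type, ite_and, eq_comm]
  split_ifs <;> rfl

lemma piOp_mul_swapOp : piOp d * swapOp d = piOp d := by
  ext ⟨i, j⟩ ⟨k, l⟩
  simp [Matrix.mul_apply, swapOp, piOp, Fintype.sum_prod_type, ite_and, eq_comm]

lemma piOp_mul_piOp : piOp d * piOp d = (d : ℂ) • piOp d := by
  ext ⟨i, j⟩ ⟨k, l⟩
  simp [Matrix.mul_apply, piOp, Fintype.sum_prod_type, ite_and]
  split_ifs <;> rfl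

lemma continuous_conjTensorSquare (A : Matrix (Fin d × Fin d) (Fin d × Fin d) ℂ) :
    Continuous fun O : Matrix.orthogonalGroup (Fin d) ℝ => conjTensorSquare (OC O) A := by
  refine continuous_matrix fun ⟨i, j⟩ ⟨k, l⟩ => ?_
  simp only [conjTensorSquare_apply]
  have h : ∀ i j, Continuous fun O : Matrix.orthogonalGroup (Fin d) ℝ => OC O i j :=
    fun i j => continuous_OC.matrix_elem i j
  fun_prop

section Integral

variable [MeasurableSpace (Matrix.orthogonalGroup (Fin d) ℝ)]
  [BorelSpace (Matrix.orthogonalGroup (Fin d) ℝ)]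
  (μ : Measure (Matrix.orthogonalGroup (Fin d) ℝ)) [μ.IsHaarMeasure]
  (A : Matrix (Fin d × Fin d) (Fin d × Fin d) ℂ)

/-- A linear map on a finite-dimensional space commutes with integrals of continuous functions
on the orthogonal group. -/
lemma integral_linearMap_comp {E F : Type*} [NormedAddCommGroup E] [NormedSpace ℂ E]
    [FiniteDimensional ℂ E] [NormedAddCommGroup F] [NormedSpace ℂ F] [FiniteDimensional ℂ F]
    (L : E →ₗ[ℂ] F) {f : Matrix.orthogonalGroup (Fin d) ℝ → E} (hf : Continuous f) :
    ∫ O, L (f O) ∂μ = L (∫ O, f O ∂μ) := by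
  have : CompleteSpace E := FiniteDimensional.complete ℂ E
  have : CompleteSpace F := FiniteDimensional.complete ℂ F
  exact (LinearMap.toContinuousLinearMap L).integral_comp_comm
    (hf.integrable_of_hasCompactSupport (HasCompactSupport.of_compactSpace _))

lemma conjTensorSquare_integral (Q : Matrix.orthogonalGroup (Fin d) ℝ) :
    conjTensorSquare (OC Q) (∫ O, conjTensorSquare (OC O) A ∂μ) =
      ∫ O, conjTensorSquare (OC O) A ∂μ := by
  refine (integral_linearMap_comp μ (conjTensorSquareL (OC Q))
    (continuous_conjTensorSquare A)).symm.trans ?_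
  rw [← integral_mul_left_eq_self (μ := μ) (fun O => conjTensorSquare (OC O) A) Q]
  refine integral_congr_ae (Filter.Eventually.of_forall fun O => ?_)
  simp only [OC_mul, conjTensorSquare_mul]
  rfl

lemma trace_mul_integral [IsProbabilityMeasure μ]
    {P : Matrix (Fin d × Fin d) (Fin d × Fin d) ℂ}
    (hP : ∀ O : Matrix.orthogonalGroup (Fin d) ℝ,
      (OC O ⊗ₖ OC O) * P = P * (OC O ⊗ₖ OC O)) :
    (P * ∫ O, conjTensorSquare (OC O) A ∂μ).trace = (P * A).trace := by
  refine (integral_linearMap_comp μ (traceMulL P) (continuous_conjTensorSquare A)).symm.trans ?_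
  have h : ∀ O : Matrix.orthogonalGroup (Fin d) ℝ,
      (P * conjTensorSquare (OC O) A).trace = (P * A).trace := fun O =>
    trace_mul_conjTensorSquare (OC_transpose_mul_self O) (hP O) A
  refine (integral_congr_ae (Filter.Eventually.of_forall h)).trans ?_
  simp

end Integral

section Invariants

variable {M : Matrix (Fin d × Fin d) (Fin d × Fin d) ℂ}

lemma apply_eq_sum_of_invariant
    (hM : ∀ Q : Matrix.orthogonalGroup (Fin d) ℝ, conjTensorSquare (OC Q) M = M)
    {Q : Matrix (Fin d) (Fin d) ℝ} (hQ : Q * Qᵀ = 1) (i j k l : Fin d) :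
    M (i, j) (k, l) = ∑ a, ∑ b, ∑ c, ∑ e,
      (Q i a : ℂ) * (Q j b : ℂ) * (Q k c : ℂ) * (Q l e : ℂ) * M (a, b) (c, e) := by
  conv_lhs => rw [← hM ⟨Q, (Matrix.mem_orthogonalGroup_iff _ _).mpr hQ⟩, conjTensorSquare_apply]
  rfl

lemma apply_perm_of_invariant
    (hM : ∀ Q : Matrix.orthogonalGroup (Fin d) ℝ, conjTensorSquare (OC Q) M = M)
    (σ : Equiv.Perm (Fin d)) (i j k l : Fin d) :
    M (σ i, σ j) (σ k, σ l) = M (i, j) (k, l) := by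
  have hQ : (Matrix.of fun i j => if σ i = j then (1 : ℝ) else 0) *
      (Matrix.of fun i j => if σ i = j then (1 : ℝ) else 0)ᵀ = 1 := by
    ext i j
    simp [Matrix.mul_apply, Matrix.one_apply, eq_comm]
  conv_rhs => rw [apply_eq_sum_of_invariant hM hQ i j k l]
  simp [apply_ite Complex.ofReal]

/-- Flipping the sign of one basis vector multiplies an entry by the parity of its index. -/
lemma apply_sign_of_invariant
    (hM : ∀ Q : Matrix.orthogonalGroup (Fin d) ℝ, conjTensorSquare (OC Q) M = M)
    (x i j k l : Fin d) :
    M (i, j) (k, l) = (if i = x then -1 else 1) * (if j = x then -1 else 1) *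
      (if k = x then -1 else 1) * (if l = x then -1 else 1) * M (i, j) (k, l) := by
  have hQ : (Matrix.diagonal fun i => if i = x then (-1 : ℝ) else 1) *
      (Matrix.diagonal fun i => if i = x then (-1 : ℝ) else 1)ᵀ = 1 := by
    rw [Matrix.diagonal_transpose, Matrix.diagonal_mul_diagonal, ← Matrix.diagonal_one]
    congr 1
    ext i
    split_ifs <;> norm_num
  conv_lhs => rw [apply_eq_sum_of_invariant hM hQ i j k l]
  simp [Matrix.diagonal_apply, apply_ite Complex.ofReal]

/-- Rotating two basis vectors by a 3-4-5 triangle relates the diagonal entry to the mixed ones. -/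
lemma apply_diag_of_invariant
    (hM : ∀ Q : Matrix.orthogonalGroup (Fin d) ℝ, conjTensorSquare (OC Q) M = M)
    {x y : Fin d} (hxy : x ≠ y) :
    M (x, x) (x, x) = M (x, y) (x, y) + M (x, y) (y, x) + M (x, x) (y, y) := by
  let w : Fin d → ℝ := fun i => (if i = x then 1 else 0) - 2 * (if i = y then 1 else 0)
  have hw : w ⬝ᵥ w = 5 := by
    simp [w, dotProduct, mul_sub, sub_mul, Finset.sum_sub_distrib, hxy, hxy.symm]
    norm_num
  let Q : Matrix (Fin d) (Fin d) ℝ := 1 - (2 / 5 : ℝ) • Matrix.vecMulVec w w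
  have hQ : Q * Qᵀ = 1 := by
    have hT : Qᵀ = Q := by simp [Q, Matrix.transpose_vecMulVec]
    rw [hT]
    simp only [Q, sub_mul, mul_sub, one_mul, mul_one, smul_mul_assoc, mul_smul_comm,
      Matrix.vecMulVec_mul_vecMulVec, hw, Matrix.vecMulVec_smul, smul_smul]
    module
  have hrow : ∀ a, Q x a =
      (3 / 5) * (if a = x then 1 else 0) + (4 / 5) * (if a = y then 1 else 0) := by
    intro a
    simp only [Q, w, Matrix.sub_apply, Matrix.smul_apply, Matrix.vecMulVec_apply, Matrix.one_apply,
      smul_eq_mul, hxy, if_true, if_false, eq_comm (a := x) (b := a)]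
    split_ifs <;> norm_num
  have hsum : ∀ f : Fin d → ℂ, ∑ a, (Q x a : ℂ) * f a = 3 / 5 * f x + 4 / 5 * f y := by
    intro f
    simp [hrow, add_mul, Finset.sum_add_distrib, apply_ite Complex.ofReal]
  have h := apply_eq_sum_of_invariant hM hQ x x x x
  simp only [mul_assoc, ← Finset.mul_sum, hsum] at h
  have hyx := hxy.symm
  have h₁ := apply_sign_of_invariant hM y x x x y
  have h₂ := apply_sign_of_invariant hM y x x y x
  have h₃ := apply_sign_of_invariant hM y x y x x
  have h₄ := apply_sign_of_invariant hM y y x x x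
  have h₅ := apply_sign_of_invariant hM x y y y x
  have h₆ := apply_sign_of_invariant hM x y y x y
  have h₇ := apply_sign_of_invariant hM x y x y y
  have h₈ := apply_sign_of_invariant hM x x y y y
  simp only [hxy, hyx, if_true, if_false] at h₁ h₂ h₃ h₄ h₅ h₆ h₇ h₈
  have p₁ := apply_perm_of_invariant hM (Equiv.swap x y) x x x x
  have p₂ := apply_perm_of_invariant hM (Equiv.swap x y) x y x y
  have p₃ := apply_perm_of_invariant hM (Equiv.swap x y) x y y x
  have p₄ := apply_perm_of_invariant hM (Equiv.swap x y) x x y y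
  simp only [Equiv.swap_apply_left, Equiv.swap_apply_right] at p₁ p₂ p₃ p₄
  grind

lemma exists_perm_apply_eq {α : Type*} [DecidableEq α] {x y i j : α} (hxy : x ≠ y) (hij : i ≠ j) :
    ∃ σ : Equiv.Perm α, σ x = i ∧ σ y = j := by
  refine ⟨Equiv.swap (Equiv.swap x i y) j * Equiv.swap x i, ?_, ?_⟩
  · have h : i ≠ Equiv.swap x i y := fun h =>
      hxy ((Equiv.swap x i).injective ((Equiv.swap_apply_left x i).trans h))
    simp [Equiv.swap_apply_of_ne_of_ne h hij]
  · simp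

/-- A matrix invariant under all orthogonal tensor squares is a combination of `1`, `S`, `Π`. -/
lemma eq_combination_of_invariant
    (hM : ∀ Q : Matrix.orthogonalGroup (Fin d) ℝ, conjTensorSquare (OC Q) M = M) (hd : 2 ≤ d) :
    ∃ a b c : ℂ, M = a • 1 + b • swapOp d + c • piOp d := by
  obtain ⟨x, y, hxy⟩ : ∃ x y : Fin d, x ≠ y := ⟨⟨0, by omega⟩, ⟨1, by omega⟩, by simp⟩
  refine ⟨M (x, y) (x, y), M (x, y) (y, x), M (x, x) (y, y), ?_⟩
  have hpair : ∀ i j, i ≠ j → M (i, j) (i, j) = M (x, y) (x, y) ∧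
      M (i, j) (j, i) = M (x, y) (y, x) ∧ M (i, i) (j, j) = M (x, x) (y, y) := by
    intro i j hij
    obtain ⟨σ, rfl, rfl⟩ := exists_perm_apply_eq hxy hij
    simp only [apply_perm_of_invariant hM, and_self]
  have hdiag : ∀ i, M (i, i) (i, i) = M (x, y) (x, y) + M (x, y) (y, x) + M (x, x) (y, y) := by
    intro i
    have h := apply_perm_of_invariant hM (Equiv.swap x i) x x x x
    rw [Equiv.swap_apply_left] at h
    rw [h, apply_diag_of_invariant hM hxy]
  ext ⟨i, j⟩ ⟨k, l⟩
  have hi := apply_sign_of_invariant hM i i j k l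
  have hj := apply_sign_of_invariant hM j i j k l
  have hk := apply_sign_of_invariant hM k i j k l
  have hl := apply_sign_of_invariant hM l i j k l
  simp only [Matrix.add_apply, Matrix.smul_apply, Matrix.one_apply, swapOp, piOp, Matrix.of_apply,
    Prod.mk.injEq, smul_eq_mul]
  grind

end Invariants

end TensorSquare

/-- the second moment of the Haar measure on the orthogonal group. -/
theorem stmt_1 (d : ℕ) (hd : 2 ≤ d)
    [MeasurableSpace (Matrix.orthogonalGroup (Fin d) ℝ)]
    [BorelSpace (Matrix.orthogonalGroup (Fin d) ℝ)]
    (μ : Measure (Matrix.orthogonalGroup (Fin d) ℝ))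
    [μ.IsHaarMeasure] [IsProbabilityMeasure μ]
    (A : Matrix (Fin d × Fin d) (Fin d × Fin d) ℂ)
    (γ₁ γ₂ γ₃ : ℂ)
    (hγ₁ : γ₁ = (((d : ℂ) + 1) * A.trace - (swapOp d * A).trace - (piOp d * A).trace) /
      ((d : ℂ) * ((d : ℂ) - 1) * ((d : ℂ) + 2)))
    (hγ₂ : γ₂ = (-A.trace + ((d : ℂ) + 1) * (swapOp d * A).trace - (piOp d * A).trace) /
      ((d : ℂ) * ((d : ℂ) - 1) * ((d : ℂ) + 2)))
    (hγ₃ : γ₃ = (-A.trace - (swapOp d * A).trace + ((d : ℂ) + 1) * (piOp d * A).trace) /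
      ((d : ℂ) * ((d : ℂ) - 1) * ((d : ℂ) + 2))) :
    ∫ O, (OC O ⊗ₖ OC O) * A * ((OC O)ᵀ ⊗ₖ (OC O)ᵀ) ∂μ =
      γ₁ • ((1 : Matrix (Fin d) (Fin d) ℂ) ⊗ₖ (1 : Matrix (Fin d) (Fin d) ℂ)) +
        γ₂ • swapOp d + γ₃ • piOp d := by
  have hM := eq_combination_of_invariant (conjTensorSquare_integral μ A) hd
  have h₁ := trace_mul_integral μ A (P := 1) fun O => by rw [mul_one, one_mul]
  have h₂ := trace_mul_integral μ A fun O => kronecker_mul_swapOp (OC O)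
  have h₃ := trace_mul_integral μ A fun O => kronecker_mul_piOp (OC_transpose_mul_self O)
  change (∫ O, conjTensorSquare (OC O) A ∂μ) = _
  generalize (∫ O, conjTensorSquare (OC O) A ∂μ) = M at hM h₁ h₂ h₃ ⊢
  obtain ⟨a, b, c, rfl⟩ := hM
  have hd₀ : (d : ℂ) ≠ 0 := by
    exact_mod_cast (by omega : d ≠ 0)
  have hd₁ : (d : ℂ) - 1 ≠ 0 := sub_ne_zero.mpr (by exact_mod_cast (by omega : d ≠ 1))
  have hd₂ : (d : ℂ) + 2 ≠ 0 := by exact_mod_cast (by omega : d + 2 ≠ 0)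
  simp only [mul_add, mul_smul_comm, mul_one, Matrix.one_mul, swapOp_mul_swapOp, swapOp_mul_piOp,
    piOp_mul_swapOp, piOp_mul_piOp, Matrix.trace_add, Matrix.trace_smul, trace_swapOp, trace_piOp,
    Matrix.trace_one, Fintype.card_prod, Fintype.card_fin, Nat.cast_mul, smul_eq_mul] at h₁ h₂ h₃
  rw [Matrix.one_kronecker_one]
  congr 1
  · congr 1
    · rw [hγ₁, ← h₁, ← h₂, ← h₃]
      congr 1
      field_simp
      ring
    · rw [hγ₂, ← h₁, ← h₂, ← h₃]
      congr 1
      field_simp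
      ring
  · rw [hγ₃, ← h₁, ← h₂, ← h₃]
    congr 1
    field_simp
    ring
end

section
/- Let d ≥ 2, let ρ be a Hermitian complex matrix indexed by Fin d × Fin d (a two-qudit state) with tr(ρ) = 1. Let N_A, N_B be Hermitian d×d matrices with tr(N_X) = 0 and tr(N_X²) = d; let M_A, M_B be real observables (Hermitian, Mᵀ = M) with tr(M_X) = 0, tr(M_X²) = d; let M̂_A, M̂_B be imaginary observables (Hermitian, M̂ᵀ = −M̂) with tr(M̂_X²) = d. Define R = ∬ (tr((U_A ⊗ U_B)·ρ·(U_A ⊗ U_B)ᴴ·(N_A ⊗ N_B)))² dμ_U(U_A) dμ_U(U_B), Q = ∬ (tr((O_A ⊗ O_B)·ρ·(O_Aᵀ ⊗ O_Bᵀ)·(M_A ⊗ M_B)))² dμ_O(O_A) dμ_O(O_B), and Q̂ = ∬ (tr((O_A ⊗ O_B)·ρ·(O_Aᵀ ⊗ O_Bᵀ)·(M̂_A ⊗ M̂_B)))² dμ_O(O_A) dμ_O(O_B). Then, with L = (d−1)(d+2)/2 and L̂ = d(d−1)/2, the real quantities satisfy L²·Q + L̂²·Q̂ ≤ (d²−1)²·R;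 moreover, if ρᵀ = ρ then equality holds. -/
open MeasureTheory Matrix Kronecker

/-- The rank-four tensor `T` is fixed by the action of the matrix `V` that conjugates the first and
the third slot. -/
def IsFixedBy {n : Type*} [Fintype n] (T : n → n → n → n → ℂ) (V : Matrix n n ℂ) : Prop :=
  ∀ i j k l, T i j k l =
    ∑ a, ∑ b, ∑ c, ∑ e, star (V a i) * V b j * star (V c k) * V e l * T a b c e

theorem IsFixedBy.diagonal {n : Type*} [Fintype n] [DecidableEq n] {T : n → n → n → n → ℂ}
    {s : n → ℂ} (h : IsFixedBy T (diagonal s)) (i j k l : n) :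
    T i j k l = star (s i) * s j * star (s k) * s l * T i j k l := by
  have := h i j k l
  simpa [diagonal_apply, apply_ite (starRingEnd ℂ), ite_mul, mul_ite] using this

theorem IsFixedBy.perm {n : Type*} [Fintype n] [DecidableEq n] {T : n → n → n → n → ℂ}
    {σ : Equiv.Perm n} (h : IsFixedBy T (of fun a b => if a = σ b then 1 else 0)) (i j k l : n) :
    T i j k l = T (σ i) (σ j) (σ k) (σ l) := by
  have := h i j k l
  simpa [apply_ite (starRingEnd ℂ), ite_mul, mul_ite] using this

theorem Equiv.Perm.exists_map_pair {n : Type*} [DecidableEq n] {a b i j : n} (hab : a ≠ b)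
    (hij : i ≠ j) : ∃ σ : Equiv.Perm n, σ a = i ∧ σ b = j := by
  refine ⟨Equiv.swap (Equiv.swap a i b) j * Equiv.swap a i, ?_, ?_⟩
  · have h : i ≠ Equiv.swap a i b := fun h => hab (by
      have := congrArg (Equiv.swap a i) h
      simpa using this)
    simp [Equiv.swap_apply_of_ne_of_ne h hij]
  · simp

/-- The reflection of `ℝⁿ` exchanging `e i` with `3/5 e i + 4/5 e j`. -/
noncomputable def planeReflection {n : Type*} [DecidableEq n] (i j : n) : Matrix n n ℝ :=
  1 - (2 / 5 : ℝ) • vecMulVec (Pi.single i 1 - Pi.single j 2)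
    (Pi.single i 1 - Pi.single j 2)

theorem planeReflection_mem_orthogonalGroup {n : Type*} [Fintype n] [DecidableEq n] {i j : n}
    (hij : i ≠ j) : planeReflection i j ∈ orthogonalGroup n ℝ := by
  rw [mem_orthogonalGroup_iff, planeReflection]
  have h5 : (Pi.single i 1 - Pi.single j 2 : n → ℝ) ⬝ᵥ (Pi.single i 1 - Pi.single j 2) = 5 := by
    simp [hij]
    norm_num
  simp only [transpose_sub, transpose_one, transpose_smul, transpose_vecMulVec, sub_mul, mul_sub,
    one_mul, mul_one, smul_mul_assoc, mul_smul_comm, vecMulVec_mul_vecMulVec, h5]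
  ext a b
  simp [vecMulVec_apply]
  ring

theorem planeReflection_apply {n : Type*} [DecidableEq n] {i j : n} (hij : i ≠ j) (a : n) :
    planeReflection i j a i = (if a = i then 3 / 5 else 0) + (if a = j then 4 / 5 else 0) := by
  by_cases hi : a = i
  · subst hi
    simp [planeReflection, vecMulVec_apply, hij]
    norm_num
  · by_cases hj : a = j
    · subst hj
      simp [planeReflection, vecMulVec_apply, hij, hij.symm]
      norm_num
    · simp [planeReflection, vecMulVec_apply, hi, hj]

/-- Fourth-order isotropic tensors are combinations of the three pairings of the indices. -/
theorem isotropic_tensor_eq {n : Type*} [Fintype n] [DecidableEq n] {T : n → n → n → n → ℂ}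
    (h : ∀ O ∈ orthogonalGroup n ℝ, IsFixedBy T (O.map Complex.ofReal)) {p q : n} (hpq : p ≠ q)
    (i j k l : n) :
    T i j k l = T p p q q * (if i = j ∧ k = l then 1 else 0) +
      T p q p q * (if i = k ∧ j = l then 1 else 0) +
      T p q q p * (if i = l ∧ j = k then 1 else 0) := by
  have hperm (σ : Equiv.Perm n) (i j k l : n) : T i j k l = T (σ i) (σ j) (σ k) (σ l) := by
    refine IsFixedBy.perm ?_ i j k l
    convert h (of fun a b => if a = σ b then 1 else 0) ?_ using 1
    · ext a b
      simp [apply_ite Complex.ofReal]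
    · rw [mem_orthogonalGroup_iff']
      ext a b
      simp [mul_apply, one_apply, eq_comm]
  have hflip (m i j k l : n) : T i j k l = (if i = m then -1 else 1) * (if j = m then -1 else 1) *
      (if k = m then -1 else 1) * (if l = m then -1 else 1) * T i j k l := by
    have := IsFixedBy.diagonal (s := fun x => if x = m then -1 else 1) (T := T) ?_ i j k l
    · simpa [apply_ite (starRingEnd ℂ)] using this
    convert h (Matrix.diagonal fun x => if x = m then -1 else 1) ?_ using 1
    · ext a b
      by_cases hab : a = b <;> simp [hab, apply_ite Complex.ofReal]
    · rw [mem_orthogonalGroup_iff']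
      ext a b
      by_cases hab : a = b
      · subst hab
        by_cases ham : a = m <;> simp [ham]
      · simp [hab]
  have hα {i k : n} (hik : i ≠ k) : T i i k k = T p p q q := by
    obtain ⟨σ, rfl, rfl⟩ := Equiv.Perm.exists_map_pair hpq hik
    exact (hperm σ _ _ _ _).symm
  have hβ {i k : n} (hik : i ≠ k) : T i k i k = T p q p q := by
    obtain ⟨σ, rfl, rfl⟩ := Equiv.Perm.exists_map_pair hpq hik
    exact (hperm σ _ _ _ _).symm
  have hγ {i k : n} (hik : i ≠ k) : T i k k i = T p q q p := by
    obtain ⟨σ, rfl, rfl⟩ := Equiv.Perm.exists_map_pair hpq hik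
    exact (hperm σ _ _ _ _).symm
  have hδ' (i j : n) : T i i i i = T j j j j := by
    simpa using hperm (Equiv.swap i j) i i i i
  have hodd {i j k l : n} (hm : T i j k l = - T i j k l) : T i j k l = 0 := by
    linear_combination (1 / 2) * hm
  have hδ (i : n) : T i i i i = T p p q q + T p q p q + T p q q p := by
    obtain ⟨j, hij⟩ : ∃ j, i ≠ j := by
      by_cases hip : i = p
      · exact ⟨q, hip ▸ hpq⟩
      · exact ⟨p, hip⟩
    have hr := h _ (planeReflection_mem_orthogonalGroup hij) i i i i
    simp only [map_apply, planeReflection_apply hij] at hr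
    have z1 : T i i i j = 0 := hodd (by simpa [hij] using hflip j i i i j)
    have z2 : T i i j i = 0 := hodd (by simpa [hij] using hflip j i i j i)
    have z3 : T i j i i = 0 := hodd (by simpa [hij] using hflip j i j i i)
    have z4 : T j i i i = 0 := hodd (by simpa [hij] using hflip j j i i i)
    have z5 : T j j j i = 0 := hodd (by simpa [hij] using hflip j j j j i)
    have z6 : T j j i j = 0 := hodd (by simpa [hij] using hflip j j j i j)
    have z7 : T j i j j = 0 := hodd (by simpa [hij] using hflip j j i j j)
    have z8 : T i j j j = 0 := hodd (by simpa [hij] using hflip j i j j j)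
    simp only [Complex.ofReal_add, apply_ite Complex.ofReal, Complex.ofReal_zero, star_add,
      apply_ite (star : ℂ → ℂ), star_zero, add_mul, mul_add, ite_mul, mul_ite, zero_mul, mul_zero,
      Finset.sum_add_distrib, Finset.sum_ite_eq', Finset.mem_univ, if_true,
      z1, z2, z3, z4, z5, z6, z7, z8, hα hij, hα hij.symm, hβ hij,
      hβ hij.symm, hγ hij, hγ hij.symm, hδ' j i] at hr
    simp at hr
    linear_combination (625 / 288) * hr
  by_cases hij : i = j
  · subst hij
    by_cases hkl : k = l
    · subst hkl
      by_cases hik : i = k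
      · subst hik
        simp [hδ]
      · simp [hik, hα hik]
    · have h0 : T i i k l = 0 := by
        by_cases hik : i = k
        · exact hodd (by simpa [hik, Ne.symm hkl] using hflip k i i k l)
        · exact hodd (by simpa [hik, Ne.symm hkl] using hflip k i i k l)
      rw [h0]
      have : ¬ (i = k ∧ i = l) := fun h => hkl (h.1.symm.trans h.2)
      have h' : ¬ (i = l ∧ i = k) := fun h => hkl (h.2.symm.trans h.1)
      simp [hkl, this, h']
  · by_cases hik : i = k
    · subst hik
      by_cases hjl : j = l
      · subst hjl
        simp [hij, Ne.symm hij, hβ hij]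
      · have h0 : T i j i l = 0 :=
          hodd (by simpa [hij, Ne.symm hjl] using hflip j i j i l)
        simp [h0, hij, hjl, Ne.symm hij]
    · by_cases hil : i = l
      · subst hil
        by_cases hjk : j = k
        · subst hjk
          simp [hij, hγ hij]
        · have h0 : T i j k i = 0 :=
            hodd (by simpa [hij, Ne.symm hjk] using hflip j i j k i)
          simp [h0, hij, hik, hjk]
      · have h0 : T i j k l = 0 :=
          hodd (by simpa [Ne.symm hij, Ne.symm hik, Ne.symm hil] using hflip i i j k l)
        simp [h0, hij, hik, hil]

theorem Matrix.isCompact_unitaryGroup {n 𝕜 : Type*} [Fintype n] [DecidableEq n] [RCLike 𝕜] :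
    IsCompact (unitaryGroup n 𝕜 : Set (Matrix n n 𝕜)) := by
  refine IsCompact.of_isClosed_subset
    (isCompact_univ_pi fun _ : n => isCompact_univ_pi fun _ : n => isCompact_closedBall (0 : 𝕜) 1)
    isClosed_unitary ?_
  intro U hU i _ j _
  simpa using entry_norm_bound_of_unitary hU i j

instance Matrix.compactSpace_unitaryGroup {n 𝕜 : Type*} [Fintype n] [DecidableEq n] [RCLike 𝕜] :
    CompactSpace (unitaryGroup n 𝕜) :=
  isCompact_iff_compactSpace.mp isCompact_unitaryGroup

theorem isMulRightInvariant_of_compactSpace {G : Type*} [Group G] [TopologicalSpace G]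
    [IsTopologicalGroup G] [CompactSpace G] [MeasurableSpace G] [BorelSpace G] (μ : Measure G)
    [μ.IsHaarMeasure] [IsProbabilityMeasure μ] : μ.IsMulRightInvariant := by
  refine ⟨fun g => ?_⟩
  have : IsProbabilityMeasure (μ.map (· * g)) :=
    Measure.isProbabilityMeasure_map (measurable_mul_const g).aemeasurable
  exact Measure.isHaarMeasure_eq_of_isProbabilityMeasure _ _

/-- The observable `N` rotated by the group element `g` through the representation `φ`. -/
noncomputable def rotated {G n : Type*} [Group G] [Fintype n] [DecidableEq n]
    (φ : G →* unitaryGroup n ℂ) (N : Matrix n n ℂ) (g : G) : Matrix n n ℂ :=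
  (φ g : Matrix n n ℂ)ᴴ * N * (φ g : Matrix n n ℂ)

/-- The second moment tensor of the random matrix `rotated φ N g`. -/
noncomputable def twirl {G n : Type*} [Group G] [MeasurableSpace G] [Fintype n] [DecidableEq n]
    (μ : Measure G) (φ : G →* unitaryGroup n ℂ) (N : Matrix n n ℂ) (i j k l : n) : ℂ :=
  ∫ g, rotated φ N g i j * rotated φ N g k l ∂μ

/-- The quadratic form in `ρ` obtained by contracting `ρ ⊗ ρ` with one tensor for each party. -/
def pairing {n : Type*} [Fintype n] (T S : n → n → n → n → ℂ) (ρ : Matrix (n × n) (n × n) ℂ) : ℂ :=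
  ∑ x, ∑ y, ∑ z, ∑ w, ρ x y * ρ z w * (T y.1 x.1 w.1 z.1 * S y.2 x.2 w.2 z.2)

theorem trace_kronecker_conj {n : Type*} [Fintype n] {UA UB NA NB : Matrix n n ℂ}
    {ρ : Matrix (n × n) (n × n) ℂ} :
    ((UA ⊗ₖ UB) * ρ * (UA ⊗ₖ UB)ᴴ * (NA ⊗ₖ NB)).trace =
      (ρ * ((UAᴴ * NA * UA) ⊗ₖ (UBᴴ * NB * UB))).trace := by
  rw [conjTranspose_kronecker, Matrix.mul_assoc, Matrix.mul_assoc, trace_mul_comm]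
  simp only [Matrix.mul_assoc, mul_kronecker_mul]

theorem ofReal_re_trace_mul {m : Type*} [Fintype m] {A B : Matrix m m ℂ} (hA : A.IsHermitian)
    (hB : B.IsHermitian) : ((A * B).trace.re : ℂ) = (A * B).trace := by
  rw [← Complex.conj_eq_iff_re]
  change star _ = _
  rw [← trace_conjTranspose, conjTranspose_mul, hA.eq, hB.eq, trace_mul_comm]

theorem integral_sum_four {G ι : Type*} [MeasurableSpace G] [Fintype ι] {μ : Measure G}
    {f : ι → ι → ι → ι → G → ℂ} (hf : ∀ a b c e, Integrable (f a b c e) μ) :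
    ∫ g, ∑ a, ∑ b, ∑ c, ∑ e, f a b c e g ∂μ = ∑ a, ∑ b, ∑ c, ∑ e, ∫ g, f a b c e g ∂μ := by
  rw [integral_finsetSum _ fun a _ => integrable_finsetSum _ fun b _ =>
    integrable_finsetSum _ fun c _ => integrable_finsetSum _ fun e _ => hf a b c e]
  refine Finset.sum_congr rfl fun a _ => ?_
  rw [integral_finsetSum _ fun b _ => integrable_finsetSum _ fun c _ =>
    integrable_finsetSum _ fun e _ => hf a b c e]
  refine Finset.sum_congr rfl fun b _ => ?_
  rw [integral_finsetSum _ fun c _ => integrable_finsetSum _ fun e _ => hf a b c e]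
  refine Finset.sum_congr rfl fun c _ => ?_
  rw [integral_finsetSum _ fun e _ => hf a b c e]

section Rotated

variable {G n : Type*} [Group G] [Fintype n] [DecidableEq n] {φ : G →* unitaryGroup n ℂ}
  {N : Matrix n n ℂ}

theorem coe_mul_star_coe (U : unitaryGroup n ℂ) :
    (U : Matrix n n ℂ) * (U : Matrix n n ℂ)ᴴ = 1 :=
  mem_unitaryGroup_iff.mp U.2

theorem rotated_mul (g h : G) :
    rotated φ N (g * h) = (φ h : Matrix n n ℂ)ᴴ * rotated φ N g * (φ h : Matrix n n ℂ) := by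
  simp [rotated, Matrix.mul_assoc]

theorem isHermitian_rotated (hN : N.IsHermitian) (g : G) : (rotated φ N g).IsHermitian :=
  isHermitian_conjTranspose_mul_mul _ hN

theorem trace_rotated (g : G) : (rotated φ N g).trace = N.trace := by
  rw [rotated, trace_mul_cycle, coe_mul_star_coe, Matrix.one_mul]

theorem rotated_mul_rotated (g : G) : rotated φ N g * rotated φ N g = rotated φ (N * N) g := by
  simp only [rotated, Matrix.mul_assoc]
  rw [← Matrix.mul_assoc _ _ (N * _), coe_mul_star_coe, Matrix.one_mul]

theorem continuous_rotated [TopologicalSpace G] (hφ : Continuous φ) :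
    Continuous (rotated φ N) := by
  unfold rotated
  fun_prop

variable [TopologicalSpace G] [CompactSpace G] [MeasurableSpace G] [BorelSpace G]
  {μ : Measure G} [IsProbabilityMeasure μ]

theorem integrable_rotated (hφ : Continuous φ) (i j k l : n) :
    Integrable (fun g => rotated φ N g i j * rotated φ N g k l) μ := by
  have h := continuous_rotated (N := N) hφ
  refine Continuous.integrable_of_hasCompactSupport ?_ (HasCompactSupport.of_compactSpace _)
  exact (h.matrix_elem i j).mul (h.matrix_elem k l)

theorem isFixedBy_twirl [IsTopologicalGroup G] [μ.IsHaarMeasure] (hφ : Continuous φ) (h : G) :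
    IsFixedBy (twirl μ φ N) (φ h : Matrix n n ℂ) := by
  intro i j k l
  have := isMulRightInvariant_of_compactSpace μ
  calc twirl μ φ N i j k l
      = ∫ g, rotated φ N (g * h) i j * rotated φ N (g * h) k l ∂μ :=
        (integral_mul_right_eq_self (fun g => rotated φ N g i j * rotated φ N g k l) h).symm
    _ = ∫ g, ∑ a, ∑ b, ∑ c, ∑ e, star ((φ h : Matrix n n ℂ) a i) * (φ h : Matrix n n ℂ) b j *
          star ((φ h : Matrix n n ℂ) c k) * (φ h : Matrix n n ℂ) e l *
            (rotated φ N g a b * rotated φ N g c e) ∂μ := by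
        congr 1 with g
        have key (i j : n) : rotated φ N (g * h) i j = ∑ a, ∑ b,
            star ((φ h : Matrix n n ℂ) a i) * (φ h : Matrix n n ℂ) b j * rotated φ N g a b := by
          simp only [rotated_mul, mul_apply, conjTranspose_apply, Finset.sum_mul]
          rw [Finset.sum_comm]
          exact Finset.sum_congr rfl fun _ _ => Finset.sum_congr rfl fun _ _ => by ring
        rw [key, key]
        rw [Finset.sum_mul]
        refine Finset.sum_congr rfl fun a _ => ?_
        rw [Finset.sum_mul]
        refine Finset.sum_congr rfl fun b _ => ?_
        rw [Finset.mul_sum]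
        refine Finset.sum_congr rfl fun c _ => ?_
        rw [Finset.mul_sum]
        exact Finset.sum_congr rfl fun e _ => by ring
    _ = _ := by
        rw [integral_sum_four fun a b c e => (integrable_rotated hφ a b c e).const_mul _]
        simp_rw [integral_const_mul, twirl]

theorem sum_twirl_trace (hφ : Continuous φ) (i j : n) (hN : N.trace = 0) :
    ∑ k, twirl μ φ N i j k k = 0 := by
  simp only [twirl]
  rw [← integral_finsetSum _ fun k _ => integrable_rotated hφ i j k k]
  have (g : G) : ∑ k, rotated φ N g i j * rotated φ N g k k = 0 := by
    rw [← Finset.mul_sum]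
    change _ * (rotated φ N g).trace = 0
    rw [trace_rotated, hN, mul_zero]
  simp [this]

theorem sum_twirl_swap (hφ : Continuous φ) :
    ∑ i, ∑ j, twirl μ φ N i j j i = (N * N).trace := by
  simp only [twirl]
  simp_rw [← integral_finsetSum _ fun k _ => integrable_rotated (μ := μ) (N := N) hφ _ k k _]
  rw [← integral_finsetSum _ fun i _ => integrable_finsetSum _ fun j _ =>
    integrable_rotated hφ i j j i]
  have (g : G) : ∑ i, ∑ j, rotated φ N g i j * rotated φ N g j i = (N * N).trace := by
    rw [← trace_rotated (φ := φ) g, ← rotated_mul_rotated]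
    simp [trace, mul_apply]
  simp [this]

theorem integral_sq_eq_pairing (hφ : Continuous φ) {NA NB : Matrix n n ℂ} (hNA : NA.IsHermitian)
    (hNB : NB.IsHermitian) {ρ : Matrix (n × n) (n × n) ℂ} (hρ : ρ.IsHermitian) :
    ((∫ g, ∫ h, ((((φ g : Matrix n n ℂ) ⊗ₖ (φ h : Matrix n n ℂ)) * ρ *
      ((φ g : Matrix n n ℂ) ⊗ₖ (φ h : Matrix n n ℂ))ᴴ * (NA ⊗ₖ NB)).trace.re) ^ 2 ∂μ ∂μ : ℝ) : ℂ) =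
      pairing (twirl μ φ NA) (twirl μ φ NB) ρ := by
  have key (g h : G) : (((((φ g : Matrix n n ℂ) ⊗ₖ (φ h : Matrix n n ℂ)) * ρ *
      ((φ g : Matrix n n ℂ) ⊗ₖ (φ h : Matrix n n ℂ))ᴴ * (NA ⊗ₖ NB)).trace.re ^ 2 : ℝ) : ℂ) =
      ∑ x, ∑ y, ∑ z, ∑ w, ρ x y * ρ z w *
        ((rotated φ NA g y.1 x.1 * rotated φ NA g w.1 z.1) *
          (rotated φ NB h y.2 x.2 * rotated φ NB h w.2 z.2)) := by
    rw [trace_kronecker_conj]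
    change (((ρ * (rotated φ NA g ⊗ₖ rotated φ NB h)).trace.re ^ 2 : ℝ) : ℂ) = _
    rw [Complex.ofReal_pow, ofReal_re_trace_mul hρ, pow_two]
    · simp only [trace, diag_apply, mul_apply, Finset.sum_mul_sum]
      refine Finset.sum_congr rfl fun x _ => ?_
      rw [Finset.sum_comm]
      refine Finset.sum_congr rfl fun y _ => ?_
      refine Finset.sum_congr rfl fun z _ => ?_
      refine Finset.sum_congr rfl fun w _ => ?_
      rw [kronecker_apply, kronecker_apply]
      ring
    · rw [IsHermitian, conjTranspose_kronecker, (isHermitian_rotated hNA g).eq,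
        (isHermitian_rotated hNB h).eq]
  have hB (x y z w : n × n) (g : G) : Integrable (fun h => ρ x y * ρ z w *
      ((rotated φ NA g y.1 x.1 * rotated φ NA g w.1 z.1) *
        (rotated φ NB h y.2 x.2 * rotated φ NB h w.2 z.2))) μ :=
    ((integrable_rotated hφ _ _ _ _).const_mul _).const_mul _
  have hA (x y z w : n × n) : Integrable (fun g => ρ x y * ρ z w *
      ((rotated φ NA g y.1 x.1 * rotated φ NA g w.1 z.1) *
        twirl μ φ NB y.2 x.2 w.2 z.2)) μ :=
    ((integrable_rotated hφ _ _ _ _).mul_const _).const_mul _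
  calc _ = ∫ g, ∑ x, ∑ y, ∑ z, ∑ w, ρ x y * ρ z w *
        ((rotated φ NA g y.1 x.1 * rotated φ NA g w.1 z.1) *
          twirl μ φ NB y.2 x.2 w.2 z.2) ∂μ := by
        rw [← integral_complex_ofReal]
        congr 1 with g
        rw [← integral_complex_ofReal]
        simp_rw [key]
        rw [integral_sum_four fun x y z w => hB x y z w g]
        simp_rw [integral_const_mul, twirl]
    _ = _ := by
        rw [integral_sum_four hA]
        simp_rw [integral_const_mul, integral_mul_const, pairing, twirl]

end Rotated

theorem pairing_smul {n : Type*} [Fintype n] {T S u v : n → n → n → n → ℂ} {c : ℂ}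
    (hT : ∀ i j k l, c * T i j k l = u i j k l) (hS : ∀ i j k l, c * S i j k l = v i j k l)
    (ρ : Matrix (n × n) (n × n) ℂ) : c ^ 2 * pairing T S ρ = pairing u v ρ := by
  simp only [pairing, Finset.mul_sum, ← hT, ← hS]
  refine Finset.sum_congr rfl fun x _ => Finset.sum_congr rfl fun y _ =>
    Finset.sum_congr rfl fun z _ => Finset.sum_congr rfl fun w _ => ?_
  ring

/-- Splitting a tensor into its symmetric part `a` and antisymmetric part `b` loses exactly the
contribution of the antisymmetric part of `ρ`. -/
theorem pairing_sub_pairing_symm_antisymm {n : Type*} [Fintype n] {u a b : n → n → n → n → ℂ}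
    (hu : ∀ i j k l, u j i l k = u i j k l)
    (ha : ∀ i j k l, a i j k l = (u i j k l + u j i k l) / 2)
    (hb : ∀ i j k l, b i j k l = (u i j k l - u j i k l) / 2) (ρ : Matrix (n × n) (n × n) ℂ) :
    pairing u u ρ - (pairing a a ρ + pairing b b ρ) = 1 / 4 * pairing u u (ρ - ρᵀ) := by
  set t : n → n → n → n → ℂ := fun i j k l => u j i k l with ht
  have hab : pairing a a ρ + pairing b b ρ = 1 / 2 * (pairing u u ρ + pairing t t ρ) := by
    simp only [pairing, Finset.mul_sum, ← Finset.sum_add_distrib, ha, hb, ht]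
    refine Finset.sum_congr rfl fun x _ => Finset.sum_congr rfl fun y _ =>
      Finset.sum_congr rfl fun z _ => Finset.sum_congr rfl fun w _ => ?_
    ring
  have hleft : ∑ x, ∑ y, ∑ z, ∑ w, ρ y x * ρ z w * (u y.1 x.1 w.1 z.1 * u y.2 x.2 w.2 z.2) =
      pairing t t ρ := by
    rw [Finset.sum_comm]
    rfl
  have hright : ∑ x, ∑ y, ∑ z, ∑ w, ρ x y * ρ w z * (u y.1 x.1 w.1 z.1 * u y.2 x.2 w.2 z.2) =
      pairing t t ρ := by
    refine Finset.sum_congr rfl fun x _ => Finset.sum_congr rfl fun y _ => ?_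
    rw [Finset.sum_comm]
    refine Finset.sum_congr rfl fun z _ => Finset.sum_congr rfl fun w _ => ?_
    rw [← hu y.1, ← hu y.2]
  have hboth : ∑ x, ∑ y, ∑ z, ∑ w, ρ y x * ρ w z * (u y.1 x.1 w.1 z.1 * u y.2 x.2 w.2 z.2) =
      pairing u u ρ := by
    rw [Finset.sum_comm]
    refine Finset.sum_congr rfl fun x _ => Finset.sum_congr rfl fun y _ => ?_
    rw [Finset.sum_comm]
    refine Finset.sum_congr rfl fun z _ => Finset.sum_congr rfl fun w _ => ?_
    rw [← hu y.1, ← hu y.2]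
  have hexp : pairing u u (ρ - ρᵀ) =
      pairing u u ρ - pairing t t ρ - pairing t t ρ + pairing u u ρ := by
    nth_rewrite 2 [← hboth]
    nth_rewrite 1 [← hleft]
    rw [← hright]
    simp only [pairing, ← Finset.sum_add_distrib, ← Finset.sum_sub_distrib]
    refine Finset.sum_congr rfl fun x _ => Finset.sum_congr rfl fun y _ =>
      Finset.sum_congr rfl fun z _ => Finset.sum_congr rfl fun w _ => ?_
    simp only [Matrix.sub_apply, transpose_apply]
    ring
  rw [hab, hexp]
  ring

theorem conjTranspose_map_ofReal {m n : Type*} (O : Matrix m n ℝ) :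
    (O.map Complex.ofReal)ᴴ = (O.map Complex.ofReal)ᵀ := by
  ext i j
  simp

theorem map_ofReal_mem_unitaryGroup {n : Type*} [Fintype n] [DecidableEq n] {O : Matrix n n ℝ}
    (hO : O ∈ orthogonalGroup n ℝ) : O.map Complex.ofReal ∈ unitaryGroup n ℂ := by
  rw [mem_unitaryGroup_iff', star_eq_conjTranspose, conjTranspose_map_ofReal, ← transpose_map]
  have h := congrArg (fun M : Matrix n n ℝ => M.map Complex.ofRealHom)
    ((mem_orthogonalGroup_iff' n ℝ).mp hO)
  rw [Matrix.map_mul] at h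
  exact h.trans (by simp)

/-- The inclusion of the orthogonal group into the unitary group. -/
def orthogonalToUnitary (n : Type*) [Fintype n] [DecidableEq n] :
    orthogonalGroup n ℝ →* unitaryGroup n ℂ where
  toFun O := ⟨(O : Matrix n n ℝ).map Complex.ofReal, map_ofReal_mem_unitaryGroup O.2⟩
  map_one' := by
    ext i j
    by_cases h : i = j <;> simp [h]
  map_mul' O P := by
    ext i j
    simp [mul_apply]

theorem continuous_orthogonalToUnitary {n : Type*} [Fintype n] [DecidableEq n] :
    Continuous (orthogonalToUnitary n) :=
  (continuous_subtype_val.matrix_map Complex.continuous_ofReal).subtype_mk _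

theorem twirl_transpose {G n : Type*} [Group G] [MeasurableSpace G] {μ : Measure G} [Fintype n]
    [DecidableEq n] {φ : G →* unitaryGroup n ℂ} {N : Matrix n n ℂ}
    (hreal : ∀ g, (φ g : Matrix n n ℂ)ᴴ = (φ g : Matrix n n ℂ)ᵀ)
    {c : ℂ} (hN : Nᵀ = c • N) (i j k l : n) :
    twirl μ φ N j i k l = c * twirl μ φ N i j k l := by
  rw [twirl, twirl, ← integral_const_mul]
  congr 1 with g
  have h : (rotated φ N g)ᵀ = c • rotated φ N g := by
    simp only [rotated, hreal, transpose_mul, transpose_transpose, hN, Matrix.mul_assoc,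
      smul_mul, Matrix.mul_smul]
  have h' := congrFun (congrFun h i) j
  rw [transpose_apply, Matrix.smul_apply, smul_eq_mul] at h'
  rw [h']
  ring

section Twirl

variable {G n : Type*} [Group G] [TopologicalSpace G] [IsTopologicalGroup G] [CompactSpace G]
  [MeasurableSpace G] [BorelSpace G] {μ : Measure G} [μ.IsHaarMeasure] [IsProbabilityMeasure μ]
  [Fintype n] [DecidableEq n] {φ : G →* unitaryGroup n ℂ} {N : Matrix n n ℂ}

theorem twirl_eq (hφ : Continuous φ)
    (hO : ∀ O ∈ orthogonalGroup n ℝ, ∃ g, (φ g : Matrix n n ℂ) = O.map Complex.ofReal)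
    {p q : n} (hpq : p ≠ q) (i j k l : n) :
    twirl μ φ N i j k l = twirl μ φ N p p q q * (if i = j ∧ k = l then 1 else 0) +
      twirl μ φ N p q p q * (if i = k ∧ j = l then 1 else 0) +
      twirl μ φ N p q q p * (if i = l ∧ j = k then 1 else 0) := by
  refine isotropic_tensor_eq (fun O hOm => ?_) hpq i j k l
  obtain ⟨g, hg⟩ := hO O hOm
  exact hg ▸ isFixedBy_twirl hφ g

theorem twirl_trace_eq (hφ : Continuous φ)
    (hO : ∀ O ∈ orthogonalGroup n ℝ, ∃ g, (φ g : Matrix n n ℂ) = O.map Complex.ofReal)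
    {p q : n} (hpq : p ≠ q) (hN : N.trace = 0) :
    twirl μ φ N p p q q * Fintype.card n + twirl μ φ N p q p q + twirl μ φ N p q q p = 0 := by
  have h := sum_twirl_trace (μ := μ) hφ p p hN
  rw [Finset.sum_congr rfl fun k _ => twirl_eq hφ hO hpq p p k k] at h
  simpa [Finset.sum_add_distrib, mul_comm] using h

theorem twirl_swap_eq (hφ : Continuous φ)
    (hO : ∀ O ∈ orthogonalGroup n ℝ, ∃ g, (φ g : Matrix n n ℂ) = O.map Complex.ofReal)
    {p q : n} (hpq : p ≠ q) :
    twirl μ φ N p p q q * Fintype.card n + twirl μ φ N p q p q * Fintype.card n +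
      twirl μ φ N p q q p * (Fintype.card n : ℂ) ^ 2 = (N * N).trace := by
  have h := sum_twirl_swap (μ := μ) (N := N) hφ
  rw [← h]
  conv_rhs => enter [2, i, 2, j]; rw [twirl_eq (μ := μ) (N := N) hφ hO hpq]
  have hand (i j : n) : (i = j ∧ j = i) ↔ j = i := ⟨And.right, fun h => ⟨h.symm, h⟩⟩
  simp [Finset.sum_add_distrib, hand]
  ring

theorem twirl_of_surjective (hφ : Continuous φ) (hU : Function.Surjective φ)
    {p q : n} (hpq : p ≠ q) (hN : N.trace = 0) (hN2 : (N * N).trace = Fintype.card n)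
    (i j k l : n) :
    ((Fintype.card n : ℂ) ^ 2 - 1) * twirl μ φ N i j k l =
      Fintype.card n * (if i = l ∧ j = k then 1 else 0) - (if i = j ∧ k = l then 1 else 0) := by
  have hO (O) (hOm : O ∈ orthogonalGroup n ℝ) :
      ∃ g, (φ g : Matrix n n ℂ) = O.map Complex.ofReal := by
    have : O.map Complex.ofReal ∈ unitaryGroup n ℂ :=
      map_ofReal_mem_unitaryGroup hOm
    obtain ⟨g, hg⟩ := hU ⟨_, this⟩
    exact ⟨g, by rw [hg]⟩
  have h1 := twirl_trace_eq (μ := μ) hφ hO hpq hN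
  have h2 := twirl_swap_eq (μ := μ) (N := N) hφ hO hpq
  have hβ : twirl μ φ N p q p q = 0 := by
    have hmem : diagonal (fun x => if x = p then Complex.I else 1) ∈ unitaryGroup n ℂ := by
      rw [mem_unitaryGroup_iff', star_eq_conjTranspose, diagonal_conjTranspose,
        diagonal_mul_diagonal, ← diagonal_one]
      congr 1 with x
      by_cases hx : x = p <;> simp [hx]
    obtain ⟨g, hg⟩ := hU ⟨_, hmem⟩
    have h := isFixedBy_twirl (μ := μ) (N := N) hφ g
    rw [hg] at h
    have h := h.diagonal p q p q
    simp [hpq.symm] at h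
    linear_combination (1 / 2) * h
  have hd : (Fintype.card n : ℂ) ≠ 0 := by
    have : Nonempty n := ⟨p⟩
    exact_mod_cast Fintype.card_ne_zero
  rw [hβ] at h1 h2
  rw [hN2] at h2
  have hγ : ((Fintype.card n : ℂ) ^ 2 - 1) * twirl μ φ N p q q p = Fintype.card n := by
    linear_combination h2 - h1
  have hα : ((Fintype.card n : ℂ) ^ 2 - 1) * twirl μ φ N p p q q = -1 := by
    refine mul_left_cancel₀ hd ?_
    linear_combination ((Fintype.card n : ℂ) ^ 2 - 1) * h1 - hγ
  rw [twirl_eq hφ hO hpq, hβ]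
  linear_combination (if i = j ∧ k = l then 1 else 0) * hα + (if i = l ∧ j = k then 1 else 0) * hγ

theorem twirl_of_symm (hφ : Continuous φ)
    (hO : ∀ O ∈ orthogonalGroup n ℝ, ∃ g, (φ g : Matrix n n ℂ) = O.map Complex.ofReal)
    (hreal : ∀ g, (φ g : Matrix n n ℂ)ᴴ = (φ g : Matrix n n ℂ)ᵀ)
    {p q : n} (hpq : p ≠ q) (hN : N.trace = 0) (hN2 : (N * N).trace = Fintype.card n)
    (hNt : Nᵀ = N) (i j k l : n) :
    ((Fintype.card n : ℂ) - 1) * (Fintype.card n + 2) / 2 * twirl μ φ N i j k l =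
      Fintype.card n / 2 * ((if i = l ∧ j = k then 1 else 0) + (if i = k ∧ j = l then 1 else 0)) -
        (if i = j ∧ k = l then 1 else 0) := by
  have h1 := twirl_trace_eq (μ := μ) hφ hO hpq hN
  have h2 := twirl_swap_eq (μ := μ) (N := N) hφ hO hpq
  have hβ : twirl μ φ N p q p q = twirl μ φ N p q q p := by
    have h := twirl_transpose (μ := μ) hreal (c := 1) (by rw [one_smul, hNt]) q p p q
    rw [h, one_mul, twirl_eq hφ hO hpq q p p q]
    simp [hpq.symm]
  have hd : (Fintype.card n : ℂ) ≠ 0 := by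
    have : Nonempty n := ⟨p⟩
    exact_mod_cast Fintype.card_ne_zero
  rw [hβ] at h1 h2
  rw [hN2] at h2
  have hγ : ((Fintype.card n : ℂ) - 1) * (Fintype.card n + 2) / 2 * twirl μ φ N p q q p =
      Fintype.card n / 2 := by
    linear_combination (h2 - h1) / 2
  have hα : ((Fintype.card n : ℂ) - 1) * (Fintype.card n + 2) / 2 * twirl μ φ N p p q q = -1 := by
    refine mul_left_cancel₀ hd ?_
    linear_combination ((Fintype.card n : ℂ) - 1) * (Fintype.card n + 2) / 2 * h1 - 2 * hγ
  rw [twirl_eq hφ hO hpq, hβ]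
  linear_combination (if i = j ∧ k = l then 1 else 0) * hα +
    ((if i = l ∧ j = k then 1 else 0) + (if i = k ∧ j = l then 1 else 0)) * hγ

theorem twirl_of_antisymm (hφ : Continuous φ)
    (hO : ∀ O ∈ orthogonalGroup n ℝ, ∃ g, (φ g : Matrix n n ℂ) = O.map Complex.ofReal)
    (hreal : ∀ g, (φ g : Matrix n n ℂ)ᴴ = (φ g : Matrix n n ℂ)ᵀ)
    {p q : n} (hpq : p ≠ q) (hN2 : (N * N).trace = Fintype.card n)
    (hNt : Nᵀ = -N) (i j k l : n) :
    (Fintype.card n : ℂ) * (Fintype.card n - 1) / 2 * twirl μ φ N i j k l =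
      Fintype.card n / 2 *
        ((if i = l ∧ j = k then 1 else 0) - (if i = k ∧ j = l then 1 else 0)) := by
  have h2 := twirl_swap_eq (μ := μ) (N := N) hφ hO hpq
  have htr (i j k l) := twirl_transpose (μ := μ) hreal (c := -1) (by rw [neg_one_smul, hNt]) i j k l
  have hα : twirl μ φ N p p q q = 0 := by
    linear_combination (1 / 2) * htr p p q q
  have hβ : twirl μ φ N p q p q = -twirl μ φ N p q q p := by
    rw [htr q p p q, twirl_eq hφ hO hpq q p p q]
    simp [hpq.symm]
  rw [hα, hβ, hN2] at h2
  rw [twirl_eq hφ hO hpq, hα, hβ]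
  linear_combination
    ((if i = l ∧ j = k then 1 else 0) - (if i = k ∧ j = l then 1 else 0)) / 2 * h2

end Twirl

/-- for a two-qudit state, `L²·Q + L̂²·Q̂ ≤ (d²−1)²·R`, with equality
for real states. -/
theorem stmt_7 (d : ℕ) (hd : 2 ≤ d)
    [MeasurableSpace (Matrix.orthogonalGroup (Fin d) ℝ)]
    [BorelSpace (Matrix.orthogonalGroup (Fin d) ℝ)]
    (μO : Measure (Matrix.orthogonalGroup (Fin d) ℝ))
    [μO.IsHaarMeasure] [IsProbabilityMeasure μO]
    [MeasurableSpace (Matrix.unitaryGroup (Fin d) ℂ)]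
    [BorelSpace (Matrix.unitaryGroup (Fin d) ℂ)]
    (μU : Measure (Matrix.unitaryGroup (Fin d) ℂ))
    [μU.IsHaarMeasure] [IsProbabilityMeasure μU]
    (ρ : Matrix (Fin d × Fin d) (Fin d × Fin d) ℂ) (hρ : ρ.IsHermitian) (hρtr : ρ.trace = 1)
    (NA NB : Matrix (Fin d) (Fin d) ℂ) (hNA : NA.IsHermitian) (hNB : NB.IsHermitian)
    (hNAtr : NA.trace = 0) (hNBtr : NB.trace = 0)
    (hNA2 : (NA * NA).trace = (d : ℂ)) (hNB2 : (NB * NB).trace = (d : ℂ))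
    (MA MB : Matrix (Fin d) (Fin d) ℂ) (hMA : MA.IsHermitian) (hMB : MB.IsHermitian)
    (hMAreal : MAᵀ = MA) (hMBreal : MBᵀ = MB)
    (hMAtr : MA.trace = 0) (hMBtr : MB.trace = 0)
    (hMA2 : (MA * MA).trace = (d : ℂ)) (hMB2 : (MB * MB).trace = (d : ℂ))
    (MhA MhB : Matrix (Fin d) (Fin d) ℂ) (hMhA : MhA.IsHermitian) (hMhB : MhB.IsHermitian)
    (hMhAimag : MhAᵀ = -MhA) (hMhBimag : MhBᵀ = -MhB)
    (hMhA2 : (MhA * MhA).trace = (d : ℂ)) (hMhB2 : (MhB * MhB).trace = (d : ℂ))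
    (R Q Qh : ℝ)
    (hR : R = ∫ UA, ∫ UB,
      ((((UA : Matrix (Fin d) (Fin d) ℂ) ⊗ₖ (UB : Matrix (Fin d) (Fin d) ℂ)) * ρ *
        ((UA : Matrix (Fin d) (Fin d) ℂ) ⊗ₖ (UB : Matrix (Fin d) (Fin d) ℂ))ᴴ *
        (NA ⊗ₖ NB)).trace.re) ^ 2 ∂μU ∂μU)
    (hQ : Q = ∫ OA, ∫ OB,
      (((OC OA ⊗ₖ OC OB) * ρ * ((OC OA)ᵀ ⊗ₖ (OC OB)ᵀ) * (MA ⊗ₖ MB)).trace.re) ^ 2 ∂μO ∂μO)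
    (hQh : Qh = ∫ OA, ∫ OB,
      (((OC OA ⊗ₖ OC OB) * ρ * ((OC OA)ᵀ ⊗ₖ (OC OB)ᵀ) * (MhA ⊗ₖ MhB)).trace.re) ^ 2 ∂μO ∂μO) :
    (((d : ℝ) - 1) * ((d : ℝ) + 2) / 2) ^ 2 * Q + ((d : ℝ) * ((d : ℝ) - 1) / 2) ^ 2 * Qh ≤
        ((d : ℝ) ^ 2 - 1) ^ 2 * R ∧
      (ρᵀ = ρ →
        (((d : ℝ) - 1) * ((d : ℝ) + 2) / 2) ^ 2 * Q + ((d : ℝ) * ((d : ℝ) - 1) / 2) ^ 2 * Qh =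
          ((d : ℝ) ^ 2 - 1) ^ 2 * R) := by
  let D : ℂ := (d : ℂ) ^ 2 - 1
  let L : ℂ := ((d : ℂ) - 1) * ((d : ℂ) + 2) / 2
  let Lh : ℂ := (d : ℂ) * ((d : ℂ) - 1) / 2
  have hpq : (⟨0, by omega⟩ : Fin d) ≠ ⟨1, by omega⟩ := by simp
  have hcard : (Fintype.card (Fin d) : ℂ) = d := by simp
  have hφO : Continuous (orthogonalToUnitary (Fin d)) := continuous_orthogonalToUnitary
  have hO (O) (hOm : O ∈ orthogonalGroup (Fin d) ℝ) :
      ∃ g, (orthogonalToUnitary (Fin d) g : Matrix (Fin d) (Fin d) ℂ) = O.map Complex.ofReal :=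
    ⟨⟨O, hOm⟩, rfl⟩
  have hreal (g) : (orthogonalToUnitary (Fin d) g : Matrix (Fin d) (Fin d) ℂ)ᴴ =
      (orthogonalToUnitary (Fin d) g : Matrix (Fin d) (Fin d) ℂ)ᵀ :=
    conjTranspose_map_ofReal _
  have hφU : Continuous (MonoidHom.id (unitaryGroup (Fin d) ℂ)) := continuous_id
  have hsurj : Function.Surjective (MonoidHom.id (unitaryGroup (Fin d) ℂ)) :=
    Function.surjective_id
  have hOC (O P : orthogonalGroup (Fin d) ℝ) : (OC O)ᵀ ⊗ₖ (OC P)ᵀ = (OC O ⊗ₖ OC P)ᴴ := by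
    rw [conjTranspose_kronecker, OC, OC, conjTranspose_map_ofReal, conjTranspose_map_ofReal]
  simp only [hOC] at hQ hQh
  let u : Fin d → Fin d → Fin d → Fin d → ℂ := fun i j k l =>
    d * (if i = l ∧ j = k then 1 else 0) - (if i = j ∧ k = l then 1 else 0)
  let a : Fin d → Fin d → Fin d → Fin d → ℂ := fun i j k l =>
    d / 2 * ((if i = l ∧ j = k then 1 else 0) + (if i = k ∧ j = l then 1 else 0)) -
      (if i = j ∧ k = l then 1 else 0)
  let b : Fin d → Fin d → Fin d → Fin d → ℂ := fun i j k l =>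
    d / 2 * ((if i = l ∧ j = k then 1 else 0) - (if i = k ∧ j = l then 1 else 0))
  have hsplit := pairing_sub_pairing_symm_antisymm (u := u) (a := a) (b := b)
    (fun i j k l => by simp only [u, and_comm, eq_comm])
    (fun i j k l => by
      simp only [u, a, and_comm (a := j = l), eq_comm (a := j) (b := i)]
      ring)
    (fun i j k l => by
      simp only [u, b, and_comm (a := j = l), eq_comm (a := j) (b := i)]
      ring) ρ
  have hU2 (σ : Matrix (Fin d × Fin d) (Fin d × Fin d) ℂ) :
      D ^ 2 * pairing (twirl μU (MonoidHom.id _) NA) (twirl μU (MonoidHom.id _) NB) σ =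
        pairing u u σ :=
    pairing_smul
      (fun i j k l => by
        simpa only [hcard] using
          twirl_of_surjective hφU hsurj hpq hNAtr (hNA2.trans hcard.symm) i j k l)
      (fun i j k l => by
        simpa only [hcard] using
          twirl_of_surjective hφU hsurj hpq hNBtr (hNB2.trans hcard.symm) i j k l) σ
  have hUint {σ : Matrix (Fin d × Fin d) (Fin d × Fin d) ℂ} (hσ : σ.IsHermitian) :=
    integral_sq_eq_pairing (μ := μU) hφU hNA hNB hσ
  have hR' : D ^ 2 * (R : ℂ) = pairing u u ρ := by
    rw [← hU2, ← hUint hρ, hR]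
    rfl
  have hQ' : L ^ 2 * (Q : ℂ) = pairing a a ρ := by
    have h : L ^ 2 * pairing (twirl μO (orthogonalToUnitary _) MA)
        (twirl μO (orthogonalToUnitary _) MB) ρ = pairing a a ρ :=
      pairing_smul
        (fun i j k l => by
          simpa only [hcard] using
            twirl_of_symm hφO hO hreal hpq hMAtr (hMA2.trans hcard.symm) hMAreal i j k l)
        (fun i j k l => by
          simpa only [hcard] using
            twirl_of_symm hφO hO hreal hpq hMBtr (hMB2.trans hcard.symm) hMBreal i j k l) ρ
    rw [← h, ← integral_sq_eq_pairing (μ := μO) hφO hMA hMB hρ, hQ]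
    rfl
  have hQh' : Lh ^ 2 * (Qh : ℂ) = pairing b b ρ := by
    have h : Lh ^ 2 * pairing (twirl μO (orthogonalToUnitary _) MhA)
        (twirl μO (orthogonalToUnitary _) MhB) ρ = pairing b b ρ :=
      pairing_smul
        (fun i j k l => by
          simpa only [hcard] using
            twirl_of_antisymm hφO hO hreal hpq (hMhA2.trans hcard.symm) hMhAimag i j k l)
        (fun i j k l => by
          simpa only [hcard] using
            twirl_of_antisymm hφO hO hreal hpq (hMhB2.trans hcard.symm) hMhBimag i j k l) ρ
    rw [← h, ← integral_sq_eq_pairing (μ := μO) hφO hMhA hMhB hρ, hQh]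
    rfl
  rw [← hR', ← hQ', ← hQh'] at hsplit
  constructor
  · have hτ : (ρ - ρᵀ).IsHermitian := hρ.sub hρ.transpose
    rw [← hU2, ← hUint hτ] at hsplit
    set I : ℝ := ∫ g, ∫ h, _ ∂μU ∂μU
    have hI : 0 ≤ I := integral_nonneg fun g => integral_nonneg fun h => sq_nonneg _
    have hre : ((d : ℝ) ^ 2 - 1) ^ 2 * R - ((((d : ℝ) - 1) * ((d : ℝ) + 2) / 2) ^ 2 * Q +
        ((d : ℝ) * ((d : ℝ) - 1) / 2) ^ 2 * Qh) = 1 / 4 * (((d : ℝ) ^ 2 - 1) ^ 2 * I) := by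
      apply Complex.ofReal_injective
      push_cast
      exact hsplit
    have : 0 ≤ 1 / 4 * (((d : ℝ) ^ 2 - 1) ^ 2 * I) := by positivity
    linarith
  · intro hρt
    have hzero : pairing u u (ρ - ρᵀ) = 0 := by simp [hρt, pairing]
    rw [hzero, mul_zero] at hsplit
    have hre : ((d : ℝ) ^ 2 - 1) ^ 2 * R - ((((d : ℝ) - 1) * ((d : ℝ) + 2) / 2) ^ 2 * Q +
        ((d : ℝ) * ((d : ℝ) - 1) / 2) ^ 2 * Qh) = 0 := by
      apply Complex.ofReal_injective
      push_cast
      exact hsplit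
    linarith
end
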